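/- arXiv:2402.08877 — 9 statements merged into one kernel-verified Lean document; each statement's English description precedes it below -/
import Mathlib

section
/- Let p, n ≥ 1, let A be an invertible real p×p matrix with columns a_1,…,a_p, let b_1,…,b_p denote the rows of A⁻¹, and let R_1,…,R_p be invertible real n×n matrices. Then the LMC covariance matrix ∑_{j=1}^p R_j ⊗ (a_j a_jᵀ) is invertible, with inverse given by (∑_{j=1}^p R_j ⊗ a_j a_jᵀ)⁻¹ = ∑_{j=1}^p R_j⁻¹ ⊗ (b_jᵀ b_j). -/
open Matrix
open scoped Kronecker

/-- The sum of the outer products of the columns of `A` with the rows of `B` is `A * B`. -/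
theorem sum_vecMulVec_col_row {ι m n α : Type*} [Fintype ι] [NonUnitalNonAssocSemiring α]
    (A : Matrix m ι α) (B : Matrix ι n α) :
    ∑ j, vecMulVec (fun i => A i j) (fun k => B j k) = A * B := by
  ext i k
  simp [Matrix.sum_apply, vecMulVec_apply, mul_apply]

/-- If `B` is a left inverse of `A`, then `∑ⱼ Rⱼ⁻¹ ⊗ bⱼᵀbⱼ` is a right inverse of
`∑ⱼ Rⱼ ⊗ aⱼaⱼᵀ`, where `aⱼ` are the columns of `A` and `bⱼ` the rows of `B`. -/
theorem sum_kronecker_vecMulVec_mul_eq_one {ι m α : Type*} [Fintype ι] [DecidableEq ι]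
    [Fintype m] [DecidableEq m] [CommRing α] {A B : Matrix ι ι α} (hBA : B * A = 1)
    {R : ι → Matrix m m α} (hR : ∀ j, IsUnit (R j).det) :
    (∑ j, R j ⊗ₖ vecMulVec (fun i => A i j) (fun k => A k j)) *
      (∑ j, (R j)⁻¹ ⊗ₖ vecMulVec (fun i => B j i) (fun k => B j k)) = 1 := by
  have hdot (j l : ι) : (fun k => A k j) ⬝ᵥ (fun i => B l i) = (1 : Matrix ι ι α) l j := by
    rw [dotProduct_comm, ← hBA]
    rfl
  have hterm (j l : ι) :
      R j ⊗ₖ vecMulVec (fun i => A i j) (fun k => A k j) *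
        (R l)⁻¹ ⊗ₖ vecMulVec (fun i => B l i) (fun k => B l k) =
      if l = j then (1 : Matrix m m α) ⊗ₖ vecMulVec (fun i => A i j) (fun k => B j k)
      else 0 := by
    rw [← mul_kronecker_mul, vecMulVec_mul_vecMulVec, hdot]
    split_ifs with h
    · subst h
      simp [mul_nonsing_inv _ (hR l)]
    · simp [one_apply_ne h]
  have hsum : ∑ j, (1 : Matrix m m α) ⊗ₖ vecMulVec (fun i => A i j) (fun k => B j k) =
      1 ⊗ₖ ∑ j, vecMulVec (fun i => A i j) (fun k => B j k) :=
    (map_sum (kroneckerBilinear (R := α) (α := α) (1 : Matrix m m α)) _ _).symm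
  simp only [Finset.sum_mul_sum, hterm, Finset.sum_ite_eq', Finset.mem_univ, if_true, hsum]
  rw [sum_vecMulVec_col_row, mul_eq_one_comm.mp hBA, one_kronecker_one]

/-- **Inverse of the LMC covariance matrix.**
If `A` is invertible with columns `aⱼ` and `bⱼ` are the rows of `A⁻¹`, and the
`Rⱼ` are invertible, then `(∑ⱼ Rⱼ ⊗ aⱼaⱼᵀ)⁻¹ = ∑ⱼ Rⱼ⁻¹ ⊗ bⱼᵀbⱼ`. -/
theorem lmc_inverse (p n : ℕ) (hp : 1 ≤ p) (hn : 1 ≤ n)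
    (A : Matrix (Fin p) (Fin p) ℝ) (hA : IsUnit A.det)
    (R : Fin p → Matrix (Fin n) (Fin n) ℝ) (hR : ∀ j, IsUnit (R j).det) :
    IsUnit (∑ j : Fin p, (R j) ⊗ₖ vecMulVec (fun i => A i j) (fun k => A k j)).det ∧
      (∑ j : Fin p, (R j) ⊗ₖ vecMulVec (fun i => A i j) (fun k => A k j))⁻¹ =
        ∑ j : Fin p, (R j)⁻¹ ⊗ₖ vecMulVec (fun i => A⁻¹ j i) (fun k => A⁻¹ j k) := by
  have h := sum_kronecker_vecMulVec_mul_eq_one (nonsing_inv_mul A hA) hR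
  exact ⟨isUnit_det_of_right_inverse h, inv_eq_right_inv h⟩
end

section
/- Let p, n ≥ 1, let A be an invertible real p×p matrix with columns a_1,…,a_p, and let R_1,…,R_p be real n×n matrices. Then det(∑_{j=1}^p R_j ⊗ (a_j a_jᵀ)) = det(A)^{2n} · ∏_{j=1}^p det(R_j). -/
open Matrix
open scoped Kronecker

theorem blockDiagonal_eq_sum_kronecker_single {m n o α : Type*} [Fintype o] [DecidableEq o]
    [NonAssocSemiring α] (R : o → Matrix m n α) :
    blockDiagonal R = ∑ j, R j ⊗ₖ (Matrix.single j j 1 : Matrix o o α) := by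
  ext ⟨s, i⟩ ⟨t, k⟩
  simp [blockDiagonal_apply, Matrix.sum_apply, Matrix.single_apply, ite_and]

theorem mul_single_mul_transpose {m o α : Type*} [Fintype o] [DecidableEq o] [CommSemiring α]
    (A : Matrix m o α) (j : o) :
    A * (Matrix.single j j 1 : Matrix o o α) * Aᵀ = vecMulVec (fun i => A i j) (fun k => A k j) := by
  rw [Matrix.single_eq_single_vecMulVec_single, mul_vecMulVec, vecMulVec_mul]
  ext i k
  simp [vecMulVec_apply]

theorem sum_kronecker_vecMulVec_col {n o α : Type*} [Fintype n] [DecidableEq n] [Fintype o]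
    [DecidableEq o] [CommSemiring α] (A : Matrix o o α) (R : o → Matrix n n α) :
    ∑ j, R j ⊗ₖ vecMulVec (fun i => A i j) (fun k => A k j) =
      (1 ⊗ₖ A) * blockDiagonal R * (1 ⊗ₖ Aᵀ) := by
  rw [blockDiagonal_eq_sum_kronecker_single, Finset.mul_sum, Finset.sum_mul]
  simp [← mul_kronecker_mul, mul_single_mul_transpose]

/-- **Determinant of the LMC covariance matrix.**
`det(∑ⱼ Rⱼ ⊗ aⱼaⱼᵀ) = det(A)^(2n) · ∏ⱼ det(Rⱼ)`. -/
theorem lmc_determinant (p n : ℕ) (hp : 1 ≤ p) (hn : 1 ≤ n)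
    (A : Matrix (Fin p) (Fin p) ℝ) (hA : IsUnit A.det)
    (R : Fin p → Matrix (Fin n) (Fin n) ℝ) :
    (∑ j : Fin p, (R j) ⊗ₖ vecMulVec (fun i => A i j) (fun k => A k j)).det =
      A.det ^ (2 * n) * ∏ j : Fin p, (R j).det := by
  rw [sum_kronecker_vecMulVec_col, det_mul, det_mul, det_kronecker, det_kronecker,
    det_blockDiagonal, det_transpose]
  simp only [det_one, one_pow, one_mul, Fintype.card_fin]
  ring
end

section
/- Let p, n ≥ 1, let A be an invertible real p×p matrix with columns a_1,…,a_p, and let R_1,…,R_p be symmetric positive definite real n×n matrices. Then the LMC covariance matrix ∑_{j=1}^p R_j ⊗ (a_j a_jᵀ) is symmetric positive definite. -/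
open Matrix
open scoped Kronecker

/-- The quadratic form of `R ⊗ aaᵀ` at `x` is that of `R` at the contraction of `x` along `a`. -/
theorem dotProduct_kronecker_vecMulVec_mulVec {m k : Type*} [Fintype m] [Fintype k]
    (R : Matrix m m ℝ) (a : k → ℝ) (x : m × k → ℝ) :
    x ⬝ᵥ ((R ⊗ₖ vecMulVec a a) *ᵥ x) =
      (fun s => a ⬝ᵥ fun i => x (s, i)) ⬝ᵥ (R *ᵥ fun s => a ⬝ᵥ fun i => x (s, i)) := by
  have h : (R ⊗ₖ vecMulVec a a) *ᵥ x =
      fun q => a q.2 * (R *ᵥ fun t => a ⬝ᵥ fun i => x (t, i)) q.1 := by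
    ext ⟨s, i⟩
    simp only [mulVec, dotProduct, Fintype.sum_prod_type, kroneckerMap_apply, vecMulVec_apply,
      Finset.mul_sum]
    exact Finset.sum_congr rfl fun t _ => Finset.sum_congr rfl fun k _ => by ring
  rw [h]
  simp only [dotProduct, Fintype.sum_prod_type, Finset.sum_mul]
  exact Finset.sum_congr rfl fun s _ => Finset.sum_congr rfl fun i _ => by ring

/-- **Positive definiteness of the LMC covariance matrix.**
If `A` is invertible and each `Rⱼ` is symmetric positive definite, then
`∑ⱼ Rⱼ ⊗ aⱼaⱼᵀ` is symmetric positive definite. -/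
theorem lmc_posDef (p n : ℕ) (hp : 1 ≤ p) (hn : 1 ≤ n)
    (A : Matrix (Fin p) (Fin p) ℝ) (hA : IsUnit A.det)
    (R : Fin p → Matrix (Fin n) (Fin n) ℝ) (hR : ∀ j, (R j).PosDef) :
    (∑ j : Fin p, (R j) ⊗ₖ vecMulVec (fun i => A i j) (fun k => A k j)).PosDef := by
  refine .of_dotProduct_mulVec_pos ?_ fun x hx => ?_
  · rw [IsHermitian, conjTranspose_sum]
    refine Finset.sum_congr rfl fun j _ => ?_
    ext ⟨s, i⟩ ⟨t, k⟩
    have h := (hR j).1.apply s t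
    simp only [star_trivial] at h
    simp [vecMulVec_apply, h, mul_comm]
  · simp only [star_trivial, sum_mulVec, dotProduct_sum, dotProduct_kronecker_vecMulVec_mulVec]
    obtain ⟨⟨s, i⟩, hsi⟩ := Function.ne_iff.mp hx
    have hA' : IsUnit Aᵀ := by rwa [isUnit_iff_isUnit_det, det_transpose]
    have hAx : Aᵀ *ᵥ (fun i => x (s, i)) ≠ 0 := fun h =>
      hsi (congrFun (mulVec_injective_of_isUnit hA' (h.trans (mulVec_zero _).symm)) i)
    obtain ⟨j, hj⟩ := Function.ne_iff.mp hAx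
    refine Finset.sum_pos' (fun j _ => ?_) ⟨j, Finset.mem_univ j, ?_⟩
    · simpa only [star_trivial] using (hR j).posSemidef.dotProduct_mulVec_nonneg
        fun s => (fun i => A i j) ⬝ᵥ fun i => x (s, i)
    · simpa only [star_trivial] using (hR j).dotProduct_mulVec_pos fun h => hj (congrFun h s)
end

section
/- (LMC density, Proposition 1.) Let p, n ≥ 1, let A be an invertible real p×p matrix with columns a_1,…,a_p and with b_1,…,b_p the rows of A⁻¹, let R_1,…,R_p be symmetric positive definite real n×n matrices, and let Σ = ∑_{j=1}^p R_j ⊗ (a_j a_jᵀ). Then for every real p×n matrix V, the multivariate Gaussian density with mean 0 and covariance Σ evaluated at vec(V) satisfies (2π)^{-np/2} det(Σ)^{-1/2} exp(-½ vec(V)ᵀ Σ⁻¹ vec(V)) = exp(-½ ∑_{j=1}^p b_j V R_j⁻¹ Vᵀ b_jᵀ) / ((2π)^{np/2} |det(A)|^{n} ∏_{j=1}^p det(R_j)^{1/2}). -/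
open Matrix
open scoped Kronecker

namespace LMC

variable {m o : Type*} [Fintype m] [Fintype o]

/-- The LMC covariance is the congruence transform of `blockDiagonal R` by `1 ⊗ₖ A`. -/
theorem sum_kronecker_vecMulVec_eq [DecidableEq m] [DecidableEq o]
    (A : Matrix o o ℝ) (R : o → Matrix m m ℝ) :
    ∑ j, (R j) ⊗ₖ vecMulVec (fun i => A i j) (fun k => A k j) =
      ((1 : Matrix m m ℝ) ⊗ₖ A) * blockDiagonal R * ((1 : Matrix m m ℝ) ⊗ₖ Aᵀ) := by
  ext ⟨s, i⟩ ⟨t, k⟩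
  simp only [Matrix.sum_apply, kroneckerMap_apply, vecMulVec_apply, mul_apply, Fintype.sum_prod_type,
    blockDiagonal_apply, one_apply, transpose_apply]
  simp only [ite_mul, mul_ite, one_mul, zero_mul, mul_zero, Finset.sum_ite_eq,
    Finset.sum_ite_eq', Finset.mem_univ, if_true, Finset.sum_ite_irrel, Finset.sum_const_zero]
  exact Finset.sum_congr rfl fun j _ => by ring

theorem blockDiagonal_mul_blockDiagonal_inv [DecidableEq m] [DecidableEq o]
    {R : o → Matrix m m ℝ} (hR : ∀ j, IsUnit (R j).det) :
    blockDiagonal R * blockDiagonal (fun j => (R j)⁻¹) = 1 := by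
  rw [← blockDiagonal_mul, ← blockDiagonal_one]
  congr 1
  funext j
  exact mul_nonsing_inv _ (hR j)

theorem inv_congruence_blockDiagonal [DecidableEq m] [DecidableEq o]
    (A : Matrix o o ℝ)
    {R : o → Matrix m m ℝ} (hR : ∀ j, IsUnit (R j).det) :
    (((1 : Matrix m m ℝ) ⊗ₖ A) * blockDiagonal R * ((1 : Matrix m m ℝ) ⊗ₖ Aᵀ))⁻¹ =
      ((1 : Matrix m m ℝ) ⊗ₖ A⁻¹)ᵀ * blockDiagonal (fun j => (R j)⁻¹) *
        ((1 : Matrix m m ℝ) ⊗ₖ A⁻¹) := by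
  rw [Matrix.mul_inv_rev, Matrix.mul_inv_rev, inv_kronecker, inv_kronecker, inv_one,
    inv_eq_right_inv (blockDiagonal_mul_blockDiagonal_inv hR), ← transpose_nonsing_inv,
    ← kroneckerMap_transpose, transpose_one, Matrix.mul_assoc]

theorem det_congruence_blockDiagonal [DecidableEq m] [DecidableEq o]
    (A : Matrix o o ℝ) (R : o → Matrix m m ℝ) :
    (((1 : Matrix m m ℝ) ⊗ₖ A) * blockDiagonal R * ((1 : Matrix m m ℝ) ⊗ₖ Aᵀ)).det =
      (A.det ^ Fintype.card m) ^ 2 * ∏ j, (R j).det := by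
  simp only [det_mul, det_kronecker, det_one, one_pow, one_mul, det_transpose, det_blockDiagonal]
  ring

theorem one_kronecker_mulVec_vec [DecidableEq m] (B : Matrix o o ℝ) (V : Matrix o m ℝ) :
    (((1 : Matrix m m ℝ) ⊗ₖ B) *ᵥ fun si : m × o => V si.2 si.1) =
      fun si : m × o => (B * V) si.2 si.1 := by
  ext ⟨s, i⟩
  simp [mulVec, dotProduct, Fintype.sum_prod_type, one_apply, mul_apply]

theorem vec_dotProduct_blockDiagonal_mulVec_vec [DecidableEq o]
    (Q : o → Matrix m m ℝ) (U : Matrix o m ℝ) :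
    ((fun si : m × o => U si.2 si.1) ⬝ᵥ
        (blockDiagonal Q *ᵥ fun si : m × o => U si.2 si.1)) =
      ∑ j, U j ⬝ᵥ (Q j *ᵥ U j) := by
  simp only [mulVec, dotProduct, Fintype.sum_prod_type, blockDiagonal_apply]
  rw [Finset.sum_comm]
  simp

theorem vec_dotProduct_inv_mulVec_vec [DecidableEq m] [DecidableEq o]
    (B : Matrix o o ℝ) (Q : o → Matrix m m ℝ)
    (V : Matrix o m ℝ) :
    ((fun si : m × o => V si.2 si.1) ⬝ᵥ
        ((((1 : Matrix m m ℝ) ⊗ₖ B)ᵀ * blockDiagonal Q * ((1 : Matrix m m ℝ) ⊗ₖ B)) *ᵥ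
          fun si : m × o => V si.2 si.1)) =
      ∑ j, B j ⬝ᵥ ((V * Q j * Vᵀ) *ᵥ B j) := by
  rw [← mulVec_mulVec, ← mulVec_mulVec, dotProduct_mulVec, vecMul_transpose,
    one_kronecker_mulVec_vec, vec_dotProduct_blockDiagonal_mulVec_vec]
  refine Finset.sum_congr rfl fun j _ => ?_
  rw [← mulVec_mulVec, ← mulVec_mulVec, dotProduct_mulVec (B j), mulVec_transpose,
    ← mul_apply_eq_vecMul]

end LMC

/-- **The LMC density (Proposition 1).**
The `np`-dimensional Gaussian density with mean `0` and covariance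
`Sig = ∑ⱼ Rⱼ ⊗ aⱼaⱼᵀ`, evaluated at `vec(V)`, equals
`exp(-½ ∑ⱼ bⱼ V Rⱼ⁻¹ Vᵀ bⱼᵀ) / ((2π)^{np/2} |det A|ⁿ ∏ⱼ det(Rⱼ)^{1/2})`,
where the `bⱼ` are the rows of `A⁻¹`. -/
theorem lmc_density (p n : ℕ) (hp : 1 ≤ p) (hn : 1 ≤ n)
    (A : Matrix (Fin p) (Fin p) ℝ) (hA : IsUnit A.det)
    (R : Fin p → Matrix (Fin n) (Fin n) ℝ) (hR : ∀ j, (R j).PosDef)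
    (Sig : Matrix (Fin n × Fin p) (Fin n × Fin p) ℝ)
    (hSig : Sig = ∑ j : Fin p, (R j) ⊗ₖ vecMulVec (fun i => A i j) (fun k => A k j))
    (V : Matrix (Fin p) (Fin n) ℝ) :
    (Real.sqrt ((2 * Real.pi) ^ (n * p)))⁻¹ * (Real.sqrt Sig.det)⁻¹ *
        Real.exp (-(1 / 2) * ((fun si : Fin n × Fin p => V si.2 si.1) ⬝ᵥ
          (Sig⁻¹ *ᵥ fun si : Fin n × Fin p => V si.2 si.1))) =
      Real.exp (-(1 / 2) *
          ∑ j : Fin p, (A⁻¹ j) ⬝ᵥ ((V * (R j)⁻¹ * Vᵀ) *ᵥ (A⁻¹ j))) /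
        (Real.sqrt ((2 * Real.pi) ^ (n * p)) * |A.det| ^ n *
          ∏ j : Fin p, Real.sqrt (R j).det) := by
  have hdet : ∀ j, IsUnit (R j).det := fun j => (hR j).det_pos.ne'.isUnit
  rw [hSig, LMC.sum_kronecker_vecMulVec_eq, LMC.inv_congruence_blockDiagonal A hdet,
    LMC.vec_dotProduct_inv_mulVec_vec, LMC.det_congruence_blockDiagonal, Fintype.card_fin,
    Real.sqrt_mul (sq_nonneg _), Real.sqrt_sq_eq_abs, abs_pow,
    Real.sqrt_prod _ fun j _ => (hR j).det_pos.le, mul_inv]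
  ring
end

section
/- (Conditional covariance of the LMC, Proposition 2, part 2.) Let p ≥ 1, let A be an invertible real p×p matrix with columns a_1,…,a_p. Let R_1,…,R_p be symmetric positive definite real matrices indexed by O ⊔ P with blocks R^{(j)}_{OO}, R^{(j)}_{OP}, R^{(j)}_{PO}, R^{(j)}_{PP}, and let Σ = ∑_{j=1}^p R_j ⊗ (a_j a_jᵀ) with corresponding blocks. Then the Schur complement satisfies Σ_{PP} − Σ_{PO} Σ_{OO}⁻¹ Σ_{OP} = ∑_{j=1}^p (R^{(j)}_{PP} − R^{(j)}_{PO} (R^{(j)}_{OO})⁻¹ R^{(j)}_{OP}) ⊗ (a_j a_jᵀ); in particular, the conditional covariance of the LMC given the observed block retains the LMC structure with the same coregionalization matrix A and spatial matrices equal to the Schur complements of the R_j. -/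
open Matrix
open scoped Kronecker

/-- Sums of Kronecker products with rank-one factors multiply termwise when the inner families
of vectors are biorthogonal. -/
theorem sum_kronecker_vecMulVec_mul {ι l m n q r s α : Type*} [CommSemiring α]
    [Fintype ι] [DecidableEq ι] [Fintype m] [Fintype r]
    (M : ι → Matrix l m α) (N : ι → Matrix m n α)
    (u : ι → q → α) (v w : ι → r → α) (x : ι → s → α)
    (h : ∀ j k, v j ⬝ᵥ w k = if j = k then 1 else 0) :
    (∑ j, M j ⊗ₖ vecMulVec (u j) (v j)) * (∑ k, N k ⊗ₖ vecMulVec (w k) (x k)) =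
      ∑ j, (M j * N j) ⊗ₖ vecMulVec (u j) (x j) := by
  rw [Matrix.sum_mul]
  refine Finset.sum_congr rfl fun j _ => ?_
  rw [Matrix.mul_sum, Finset.sum_eq_single j]
  · rw [← mul_kronecker_mul, vecMulVec_mul_vecMulVec, h, if_pos rfl, one_smul]
  · intro k _ hk
    rw [← mul_kronecker_mul, vecMulVec_mul_vecMulVec, h, if_neg hk.symm, zero_smul]
    ext
    simp [vecMulVec_apply]
  · simp

/-- Taking a spatial block of a sum of Kronecker products takes the block of each left factor. -/
theorem submatrix_sum_kronecker {ι l m l' m' q r α : Type*} [NonUnitalNonAssocSemiring α]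
    [Fintype ι] (M : ι → Matrix l m α) (B : ι → Matrix q r α) (f : l' → l) (g : m' → m) :
    (∑ j, M j ⊗ₖ B j).submatrix (fun x : l' × q => (f x.1, x.2))
      (fun y : m' × r => (g y.1, y.2)) = ∑ j, (M j).submatrix f g ⊗ₖ B j := by
  ext x y
  simp [Matrix.sum_apply]

/-- The inverse of a sum of Kronecker products of invertible matrices with the rank-one matrices
`aⱼaⱼᵀ`, in terms of the dual basis `b` of `a`. -/
theorem inv_sum_kronecker_vecMulVec {ι m q α : Type*} [CommRing α] [Fintype ι] [DecidableEq ι]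
    [Fintype m] [DecidableEq m] [Fintype q] [DecidableEq q]
    (M : ι → Matrix m m α) (hM : ∀ j, IsUnit (M j)) (a b : ι → q → α)
    (hab : ∀ j k, a j ⬝ᵥ b k = if j = k then 1 else 0)
    (hsum : ∑ j, vecMulVec (a j) (b j) = 1) :
    (∑ j, M j ⊗ₖ vecMulVec (a j) (a j))⁻¹ = ∑ j, (M j)⁻¹ ⊗ₖ vecMulVec (b j) (b j) := by
  refine inv_eq_right_inv ?_
  rw [sum_kronecker_vecMulVec_mul _ _ _ _ _ _ hab]
  simp only [mul_nonsing_inv _ ((isUnit_iff_isUnit_det _).mp (hM _))]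
  rw [← one_kronecker_one, ← hsum]
  ext x y
  simp [Matrix.sum_apply, Finset.mul_sum]

/-- The Schur complement of sums of Kronecker products with the rank-one matrices `aⱼaⱼᵀ` of a
basis `a` is taken termwise. -/
theorem schur_complement_sum_kronecker_vecMulVec {ι l m n q α : Type*} [CommRing α]
    [Fintype ι] [DecidableEq ι] [Fintype m] [DecidableEq m] [Fintype q] [DecidableEq q]
    (D : ι → Matrix l n α) (C : ι → Matrix l m α) (M : ι → Matrix m m α) (B : ι → Matrix m n α)
    (hM : ∀ j, IsUnit (M j)) (a b : ι → q → α)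
    (hab : ∀ j k, a j ⬝ᵥ b k = if j = k then 1 else 0)
    (hsum : ∑ j, vecMulVec (a j) (b j) = 1) :
    (∑ j, D j ⊗ₖ vecMulVec (a j) (a j)) - (∑ j, C j ⊗ₖ vecMulVec (a j) (a j)) *
        (∑ j, M j ⊗ₖ vecMulVec (a j) (a j))⁻¹ * (∑ j, B j ⊗ₖ vecMulVec (a j) (a j)) =
      ∑ j, (D j - C j * (M j)⁻¹ * B j) ⊗ₖ vecMulVec (a j) (a j) := by
  have hba : ∀ j k, b j ⬝ᵥ a k = if j = k then 1 else 0 := fun j k => by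
    rw [dotProduct_comm, hab]
    simp only [eq_comm]
  rw [inv_sum_kronecker_vecMulVec M hM a b hab hsum, sum_kronecker_vecMulVec_mul _ _ _ _ _ _ hab,
    sum_kronecker_vecMulVec_mul _ _ _ _ _ _ hba, ← Finset.sum_sub_distrib]
  refine Finset.sum_congr rfl fun j _ => ?_
  ext x y
  simp [sub_mul]

/-- **Conditional covariance of the LMC (Proposition 2, part 2).**
For `Σ = ∑ⱼ Rⱼ ⊗ aⱼaⱼᵀ` over locations `O ⊕ P`, the Schur complement of the
observed block satisfies
`Σ_PP − Σ_PO Σ_OO⁻¹ Σ_OP = ∑ⱼ (R_PP⁽ʲ⁾ − R_PO⁽ʲ⁾ (R_OO⁽ʲ⁾)⁻¹ R_OP⁽ʲ⁾) ⊗ aⱼaⱼᵀ`,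
i.e. the conditional covariance retains the LMC structure with the same
coregionalization matrix `A`. -/
theorem lmc_conditional_covariance (p : ℕ) (hp : 1 ≤ p)
    (O P : Type) [Fintype O] [Fintype P] [DecidableEq O] [DecidableEq P]
    (A : Matrix (Fin p) (Fin p) ℝ) (hA : IsUnit A.det)
    (R : Fin p → Matrix (O ⊕ P) (O ⊕ P) ℝ) (hR : ∀ j, (R j).PosDef)
    (Sig : Matrix ((O ⊕ P) × Fin p) ((O ⊕ P) × Fin p) ℝ)
    (hSig : Sig = ∑ j : Fin p, (R j) ⊗ₖ vecMulVec (fun i => A i j) (fun k => A k j))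
    (SigPP : Matrix (P × Fin p) (P × Fin p) ℝ)
    (hSigPP : SigPP = Sig.submatrix (fun si => (Sum.inr si.1, si.2))
      (fun ti => (Sum.inr ti.1, ti.2)))
    (SigPO : Matrix (P × Fin p) (O × Fin p) ℝ)
    (hSigPO : SigPO = Sig.submatrix (fun si => (Sum.inr si.1, si.2))
      (fun ti => (Sum.inl ti.1, ti.2)))
    (SigOO : Matrix (O × Fin p) (O × Fin p) ℝ)
    (hSigOO : SigOO = Sig.submatrix (fun si => (Sum.inl si.1, si.2))
      (fun ti => (Sum.inl ti.1, ti.2)))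
    (SigOP : Matrix (O × Fin p) (P × Fin p) ℝ)
    (hSigOP : SigOP = Sig.submatrix (fun si => (Sum.inl si.1, si.2))
      (fun ti => (Sum.inr ti.1, ti.2))) :
    SigPP - SigPO * SigOO⁻¹ * SigOP =
      ∑ j : Fin p,
        ((R j).toBlocks₂₂ - (R j).toBlocks₂₁ * ((R j).toBlocks₁₁)⁻¹ * (R j).toBlocks₁₂) ⊗ₖ
          vecMulVec (fun i => A i j) (fun k => A k j) := by
  subst hSigPP hSigPO hSigOO hSigOP hSig
  simp only [submatrix_sum_kronecker]
  refine schur_complement_sum_kronecker_vecMulVec (fun j => (R j).toBlocks₂₂)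
    (fun j => (R j).toBlocks₂₁) (fun j => (R j).toBlocks₁₁) (fun j => (R j).toBlocks₁₂)
    (fun j => ((hR j).submatrix Sum.inl_injective).isUnit) (fun j i => A i j) (fun j => A⁻¹ j)
    (fun j k => ?_) ?_
  · rw [dotProduct_comm]
    change (A⁻¹ * A) k j = _
    rw [nonsing_inv_mul A hA, one_apply]
    simp only [eq_comm]
  · rw [← mul_nonsing_inv A hA]
    ext i k
    simp [Matrix.sum_apply, vecMulVec_apply, mul_apply]
end

section
/- (Identifiability of the exponential LMC.) Let p ≥ 1, let A and B be invertible real p×p matrices, and let φ_1 < φ_2 < … < φ_p and ψ_1 < ψ_2 < … < ψ_p be two strictly increasing sequences of positive reals. Suppose that for all i, j ∈ {1,…,p} and all d ≥ 0, ∑_{k=1}^p A(i,k) A(j,k) exp(−φ_k d) = ∑_{k=1}^p B(i,k) B(j,k) exp(−ψ_k d). Then φ_k = ψ_k for all k, and there exist signs ε_1,…,ε_p ∈ {−1, +1} such that B(i,k) = ε_k A(i,k) for all i, k; that is, B equals A up to column sign changes. -/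
open Matrix

/-- Two finite weighted sums of point masses with the same power moments agree on all functions. -/
lemma sum_mul_eq_of_forall_sum_mul_pow_eq {ι κ F : Type*} [Fintype ι] [Fintype κ] [Field F]
    {a x : ι → F} {b y : κ → F}
    (h : ∀ n : ℕ, ∑ i, a i * x i ^ n = ∑ j, b j * y j ^ n) (g : F → F) :
    ∑ i, a i * g (x i) = ∑ j, b j * g (y j) := by
  classical
  have hpoly (P : Polynomial F) : ∑ i, a i * P.eval (x i) = ∑ j, b j * P.eval (y j) := by
    induction P using Polynomial.induction_on' with
    | add P Q hP hQ => simp only [Polynomial.eval_add, mul_add, Finset.sum_add_distrib, hP, hQ]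
    | monomial n c =>
      simp only [Polynomial.eval_monomial, mul_left_comm _ c, ← Finset.mul_sum, h n]
  let s : Finset F := Finset.univ.image x ∪ Finset.univ.image y
  have hinterp {z : F} (hz : z ∈ s) : (Lagrange.interpolate s id g).eval z = g z :=
    Lagrange.eval_interpolate_at_node g Function.injective_id.injOn hz
  have hx (i : ι) := hinterp (z := x i) (by simp [s])
  have hy (j : κ) := hinterp (z := y j) (by simp [s])
  simpa only [hx, hy] using hpoly (Lagrange.interpolate s id g)

/-- Coefficients of equal finite sums of decaying exponentials agree rate by rate. -/
lemma sum_ite_eq_of_sum_mul_exp_eq {ι κ : Type*} [Fintype ι] [Fintype κ]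
    {a φ : ι → ℝ} {b ψ : κ → ℝ}
    (h : ∀ d : ℝ, 0 ≤ d →
      ∑ k, a k * Real.exp (-(φ k) * d) = ∑ k, b k * Real.exp (-(ψ k) * d)) (s : ℝ) :
    ∑ k, (if φ k = s then a k else 0) = ∑ k, if ψ k = s then b k else 0 := by
  have hpow (n : ℕ) :
      ∑ k, a k * Real.exp (-(φ k)) ^ n = ∑ k, b k * Real.exp (-(ψ k)) ^ n := by
    simpa only [← Real.exp_nat_mul, mul_comm] using h n n.cast_nonneg
  simpa [Real.exp_eq_exp] using
    sum_mul_eq_of_forall_sum_mul_pow_eq hpow (fun z ↦ if z = Real.exp (-s) then 1 else 0)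

/-- An invertible matrix has no zero column. -/
lemma Matrix.exists_apply_ne_zero_of_isUnit_det {n R : Type*} [Fintype n] [DecidableEq n]
    [CommRing R] [Nontrivial R] {A : Matrix n n R} (hA : IsUnit A.det) (k : n) :
    ∃ i, A i k ≠ 0 := by
  by_contra! hk
  exact hA.ne_zero (Matrix.det_eq_zero_of_column_eq_zero k hk)

/-- Every rate of an exponential LMC with no zero columns occurs in any other representation. -/
lemma range_subset_range_of_sum_mul_exp_eq {ι κ n : Type*} [Fintype ι] [Fintype κ]
    {A : Matrix n ι ℝ} {B : Matrix n κ ℝ} {φ : ι → ℝ} {ψ : κ → ℝ}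
    (hA : ∀ k, ∃ i, A i k ≠ 0) (hφ : Function.Injective φ)
    (h : ∀ i j, ∀ d : ℝ, 0 ≤ d →
      ∑ k, A i k * A j k * Real.exp (-(φ k) * d) =
        ∑ k, B i k * B j k * Real.exp (-(ψ k) * d)) :
    Set.range φ ⊆ Set.range ψ := by
  classical
  rintro _ ⟨k, rfl⟩
  obtain ⟨i, hi⟩ := hA k
  by_contra hk
  have hne (l : κ) : ψ l ≠ φ k := fun hl ↦ hk ⟨l, hl⟩
  have := sum_ite_eq_of_sum_mul_exp_eq (h i i) (φ k)
  simp [hφ.eq_iff, hne, hi] at this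

/-- **Identifiability of the exponential LMC.**
If two invertible coregionalization matrices `A`, `B` with strictly increasing
positive range parameters `φ`, `ψ` induce the same exponential cross-covariance
function `C_ij(d) = ∑ₖ A i k * A j k * exp(−φ k * d)` for all `d ≥ 0`, then
`φ = ψ` and `B` equals `A` up to column sign changes. -/
theorem lmc_exponential_identifiability (p : ℕ) (hp : 1 ≤ p)
    (A B : Matrix (Fin p) (Fin p) ℝ) (hA : IsUnit A.det) (hB : IsUnit B.det)
    (φ ψ : Fin p → ℝ) (hφpos : ∀ k, 0 < φ k) (hψpos : ∀ k, 0 < ψ k)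
    (hφ : StrictMono φ) (hψ : StrictMono ψ)
    (h : ∀ i j : Fin p, ∀ d : ℝ, 0 ≤ d →
      ∑ k : Fin p, A i k * A j k * Real.exp (-(φ k) * d) =
        ∑ k : Fin p, B i k * B j k * Real.exp (-(ψ k) * d)) :
    (∀ k, φ k = ψ k) ∧
      ∃ ε : Fin p → ℝ, (∀ k, ε k = 1 ∨ ε k = -1) ∧
        ∀ i k, B i k = ε k * A i k := by
  have hA' := Matrix.exists_apply_ne_zero_of_isUnit_det hA
  have hB' := Matrix.exists_apply_ne_zero_of_isUnit_det hB
  obtain rfl : φ = ψ := (hφ.range_inj hψ).1 <| Set.Subset.antisymm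
    (range_subset_range_of_sum_mul_exp_eq hA' hφ.injective h)
    (range_subset_range_of_sum_mul_exp_eq hB' hψ.injective
      fun i j d hd ↦ (h i j d hd).symm)
  have hcol (i j k : Fin p) : A i k * A j k = B i k * B j k := by
    simpa [hφ.injective.eq_iff] using sum_ite_eq_of_sum_mul_exp_eq (h i j) (φ k)
  choose r hr using hA'
  refine ⟨fun _ ↦ rfl, fun k ↦ B (r k) k / A (r k) k, fun k ↦ ?_, fun i k ↦ ?_⟩
  · apply eq_or_eq_neg_of_sq_eq_sq
    rw [one_pow, div_pow, sq, sq, ← hcol, div_self (mul_ne_zero (hr k) (hr k))]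
  · have hBr : B (r k) k ≠ 0 := fun h0 ↦ by simpa [h0, hr k] using hcol (r k) (r k) k
    refine mul_right_cancel₀ hBr ?_
    rw [← hcol i (r k) k, div_mul_eq_mul_div, div_mul_eq_mul_div, eq_div_iff (hr k)]
    linear_combination A i k * hcol (r k) (r k) k
end

section
/- Let p ≥ 1 and let M be a p×p matrix with entries in {0,1}. If the total number of zero entries of M is strictly less than p, i.e. #{(i,j) : M(i,j) = 0} < p, then the masked determinant is not identically zero: there exists a real p×p matrix A with det(A ∘ M) ≠ 0. Consequently, if the entries of A are drawn from a distribution absolutely continuous with respect to Lebesgue measure on p×p matrices, then A ∘ M is almost surely nonsingular. -/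
open Matrix MeasureTheory

/-- If a square array of side `p` has fewer than `p` marked cells, then some cyclic diagonal
contains no marked cell. -/
lemma exists_perm_forall_notMem_of_ncard_lt {p : ℕ} [NeZero p] {Z : Set (Fin p × Fin p)}
    (hZ : Z.ncard < p) : ∃ σ : Equiv.Perm (Fin p), ∀ i, (i, σ i) ∉ Z := by
  obtain ⟨k, hk⟩ : ∃ k : Fin p, k ∉ (fun x : Fin p × Fin p => x.2 - x.1) '' Z := by
    by_contra! h
    have himage := Set.ncard_image_le (f := fun x : Fin p × Fin p => x.2 - x.1) Z.toFinite
    rw [Set.eq_univ_of_forall h, Set.ncard_univ, Nat.card_fin] at himage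
    omega
  refine ⟨Equiv.addRight k, fun i hi => hk ⟨_, hi, ?_⟩⟩
  simp

/-- If a linear pencil of matrices has a nonsingular leading matrix, then almost every member
of the pencil is nonsingular. -/
lemma Matrix.ae_det_add_smul_ne_zero {n : Type*} [Fintype n] [DecidableEq n]
    {A : Matrix n n ℝ} (hA : A.det ≠ 0) (B : Matrix n n ℝ) :
    ∀ᵐ t : ℝ, (B + t • A).det ≠ 0 := by
  set q : Polynomial ℝ :=
    det ((Polynomial.X : Polynomial ℝ) • A.map Polynomial.C + B.map Polynomial.C) with hq
  have hq0 : q ≠ 0 := by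
    intro h
    apply hA
    rw [← Polynomial.coeff_det_X_add_C_card A B, ← hq, h, Polynomial.coeff_zero]
  have heval (t : ℝ) : q.eval t = (B + t • A).det := by
    rw [hq, ← Polynomial.coe_evalRingHom, RingHom.map_det]
    congr 1
    ext i j
    simp [add_comm, mul_comm t]
  have hroots : volume {t : ℝ | q.IsRoot t} = 0 :=
    (Polynomial.finite_setOfPred_isRoot hq0).measure_zero volume
  rw [ae_iff]
  simpa [Polynomial.IsRoot, heval] using hroots

/-- If the masked determinant is not identically zero, then it vanishes only on a Lebesgue null
set. -/
lemma Matrix.ae_det_hadamard_ne_zero {n : Type*} [Fintype n] [DecidableEq n]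
    {A M : Matrix n n ℝ} (hA : (A ⊙ M).det ≠ 0) :
    ∀ᵐ f : n → n → ℝ, (Matrix.of f ⊙ M).det ≠ 0 := by
  have hcont : Continuous fun f : n → n → ℝ => (Matrix.of f ⊙ M).det := by
    refine Continuous.matrix_det (continuous_matrix fun i j => ?_)
    simp only [hadamard_apply, of_apply]
    fun_prop
  refine ae_mem_of_ae_add_linearMap_mem
    (s := {f : n → n → ℝ | (Matrix.of f ⊙ M).det ≠ 0})
    (LinearMap.toSpanSingleton ℝ (n → n → ℝ) (fun i j => A i j)) volume volume
    (isOpen_ne_fun hcont continuous_const).measurableSet fun f => ?_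
  filter_upwards [ae_det_add_smul_ne_zero hA (Matrix.of f ⊙ M)] with t ht
  convert ht using 2
  ext i j
  simp [add_mul, mul_assoc]

/-- **Masks with fewer than `p` zeros are admissible.**
If a binary mask `M` has strictly fewer than `p` zero entries, then the masked
determinant is not identically zero, and consequently `A ∘ M` is almost surely
nonsingular when `A` is drawn from any distribution absolutely continuous with
respect to Lebesgue measure. -/
theorem masked_det_not_identically_zero (p : ℕ) (hp : 1 ≤ p)
    (M : Matrix (Fin p) (Fin p) ℝ) (hM : ∀ i j, M i j = 0 ∨ M i j = 1)
    (hzeros : {ij : Fin p × Fin p | M ij.1 ij.2 = 0}.ncard < p) :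
    (∃ A : Matrix (Fin p) (Fin p) ℝ, (A ⊙ M).det ≠ 0) ∧
      ∀ μ : Measure (Fin p → Fin p → ℝ), IsProbabilityMeasure μ →
        μ ≪ volume →
        μ {f | ((Matrix.of f) ⊙ M).det = 0} = 0 := by
  have : NeZero p := ⟨by omega⟩
  have hexists : ∃ A : Matrix (Fin p) (Fin p) ℝ, (A ⊙ M).det ≠ 0 := by
    obtain ⟨σ, hσ⟩ := exists_perm_forall_notMem_of_ncard_lt hzeros
    refine ⟨σ.permMatrix ℝ, ?_⟩
    have hmask : σ.permMatrix ℝ ⊙ M = σ.permMatrix ℝ := by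
      ext i j
      by_cases hij : σ i = j
      · have hone : M i j = 1 := (hM i j).resolve_left (hij ▸ hσ i)
        simp [hone]
      · simp [Equiv.Perm.permMatrix, PEquiv.toMatrix_apply, hij]
    rw [hmask, det_permutation]
    exact_mod_cast (Equiv.Perm.sign σ).ne_zero
  refine ⟨hexists, fun μ _ hμ => hμ ?_⟩
  obtain ⟨A, hA⟩ := hexists
  simpa [ae_iff] using ae_det_hadamard_ne_zero hA
end

section
/- (Determinant for the non-stationary LMC.) Let p, n ≥ 1, let A_1,…,A_n be invertible real p×p matrices (a location-varying coregionalization matrix), and let R_1,…,R_p be real n×n matrices. Define the np×np matrix Σ indexed by pairs (s,i), s ∈ {1,…,n}, i ∈ {1,…,p}, with entries Σ((s,i),(t,k)) = ∑_{j=1}^p R_j(s,t) · A_s(i,j) · A_t(k,j). Then det(Σ) = (∏_{s=1}^n det(A_s))² · ∏_{j=1}^p det(R_j). -/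
open Matrix

/-- The covariance of the non-stationary linear model of coregionalization is the congruence
transform, by the block-diagonal matrix of coregionalization matrices, of the block-diagonal
matrix of correlation matrices. -/
theorem lmc_covariance_eq_mul {m q S : Type*} [Fintype m] [DecidableEq m] [Fintype q]
    [DecidableEq q] [CommRing S] (A : m → Matrix q q S) (R : q → Matrix m m S) :
    (Matrix.of fun si tk : m × q => ∑ j, R j si.1 tk.1 * A si.1 si.2 j * A tk.1 tk.2 j) =
      (blockDiagonal A).submatrix (Equiv.prodComm m q) (Equiv.prodComm m q) * blockDiagonal R *
        ((blockDiagonal A).submatrix (Equiv.prodComm m q) (Equiv.prodComm m q))ᵀ := by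
  ext ⟨s, i⟩ ⟨t, k⟩
  simp [Matrix.mul_apply, Fintype.sum_prod_type, blockDiagonal_apply, mul_comm]

/-- **Determinant for the non-stationary LMC.**
With a location-varying coregionalization matrix `Aₛ` and covariance
`Σ((s,i),(t,k)) = ∑ⱼ Rⱼ(s,t) Aₛ(i,j) Aₜ(k,j)`, one has
`det(Σ) = (∏ₛ det Aₛ)² · ∏ⱼ det Rⱼ`. -/
theorem nonstationary_lmc_determinant (p n : ℕ) (hp : 1 ≤ p) (hn : 1 ≤ n)
    (A : Fin n → Matrix (Fin p) (Fin p) ℝ) (hA : ∀ s, IsUnit (A s).det)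
    (R : Fin p → Matrix (Fin n) (Fin n) ℝ)
    (Sig : Matrix (Fin n × Fin p) (Fin n × Fin p) ℝ)
    (hSig : Sig = Matrix.of fun si tk : Fin n × Fin p =>
      ∑ j : Fin p, R j si.1 tk.1 * A si.1 si.2 j * A tk.1 tk.2 j) :
    Sig.det = (∏ s : Fin n, (A s).det) ^ 2 * ∏ j : Fin p, (R j).det := by
  rw [hSig, lmc_covariance_eq_mul, det_mul, det_mul, det_transpose, det_submatrix_equiv_self,
    det_blockDiagonal, det_blockDiagonal]
  ring
end

section
/- (Inverse for the non-stationary LMC.) Let p, n ≥ 1, let A_1,…,A_n be invertible real p×p matrices, and let R_1,…,R_p be invertible real n×n matrices. Define the np×np matrix Σ indexed by pairs (s,i) with entries Σ((s,i),(t,k)) = ∑_{j=1}^p R_j(s,t) · A_s(i,j) · A_t(k,j). Then Σ is invertible and its inverse has entries Σ⁻¹((s,i),(t,k)) = ∑_{j=1}^p (R_j⁻¹)(s,t) · (A_s⁻¹)(j,i) · (A_t⁻¹)(j,k). -/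
open Matrix

/-- The covariance matrix with coregionalization matrices `A s` and correlation matrices `R j`. -/
def lmcCovariance {ι κ α : Type*} [Fintype κ] [CommRing α]
    (A : ι → Matrix κ κ α) (R : κ → Matrix ι ι α) : Matrix (ι × κ) (ι × κ) α :=
  Matrix.of fun x y => ∑ j, R j x.1 y.1 * A x.1 x.2 j * A y.1 y.2 j

theorem lmcCovariance_mul_eq_one {ι κ α : Type*} [Fintype ι] [DecidableEq ι] [Fintype κ]
    [DecidableEq κ] [CommRing α] {A B : ι → Matrix κ κ α} {R S : κ → Matrix ι ι α}
    (hBA : ∀ s, B s * A s = 1) (hRS : ∀ j, R j * S j = 1) :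
    lmcCovariance A R * lmcCovariance (fun s => (B s)ᵀ) S = 1 := by
  ext ⟨s, i⟩ ⟨t, k⟩
  have hBA' (u : ι) (j' j : κ) : ∑ l, B u j' l * A u l j = if j' = j then 1 else 0 := by
    rw [← Matrix.mul_apply, hBA, Matrix.one_apply]
  have hAB (u : ι) : ∑ j, A u i j * B u j k = if i = k then 1 else 0 := by
    rw [← Matrix.mul_apply, mul_eq_one_comm.mp (hBA u), Matrix.one_apply]
  have hRS' (j : κ) : ∑ u, R j s u * S j u t = if s = t then 1 else 0 := by
    rw [← Matrix.mul_apply, hRS, Matrix.one_apply]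
  have contract (u : ι) :
      ∑ l, (∑ j, R j s u * A s i j * A u l j) * ∑ j', S j' u t * B u j' l * B t j' k =
        ∑ j, R j s u * S j u t * (A s i j * B t j k) := by
    calc
      _ = ∑ j, ∑ j', R j s u * A s i j * (S j' u t * B t j' k) * ∑ l, B u j' l * A u l j := by
        simp_rw [Finset.sum_mul_sum, Finset.mul_sum]
        rw [Finset.sum_comm]
        refine Finset.sum_congr rfl fun j _ => ?_
        rw [Finset.sum_comm]
        refine Finset.sum_congr rfl fun j' _ => Finset.sum_congr rfl fun l _ => ?_
        ring
      _ = _ := by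
        simp only [hBA', mul_ite, mul_one, mul_zero, Finset.sum_ite_eq', Finset.mem_univ, if_true]
        exact Finset.sum_congr rfl fun j _ => by ring
  simp only [lmcCovariance, Matrix.mul_apply, Matrix.of_apply, Matrix.transpose_apply,
    Fintype.sum_prod_type, contract]
  rw [Finset.sum_comm]
  simp_rw [← Finset.sum_mul, hRS', ← Finset.mul_sum]
  by_cases hst : s = t
  · subst hst
    simp [hAB, Matrix.one_apply]
  · simp [hst]

/-- **Inverse for the non-stationary LMC.**
With a location-varying coregionalization matrix `Aₛ` and covariance
`Σ((s,i),(t,k)) = ∑ⱼ Rⱼ(s,t) Aₛ(i,j) Aₜ(k,j)`, the matrix `Σ` is invertible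
with `Σ⁻¹((s,i),(t,k)) = ∑ⱼ Rⱼ⁻¹(s,t) (Aₛ⁻¹)(j,i) (Aₜ⁻¹)(j,k)`. -/
theorem nonstationary_lmc_inverse (p n : ℕ) (hp : 1 ≤ p) (hn : 1 ≤ n)
    (A : Fin n → Matrix (Fin p) (Fin p) ℝ) (hA : ∀ s, IsUnit (A s).det)
    (R : Fin p → Matrix (Fin n) (Fin n) ℝ) (hR : ∀ j, IsUnit (R j).det)
    (Sig : Matrix (Fin n × Fin p) (Fin n × Fin p) ℝ)
    (hSig : Sig = Matrix.of fun si tk : Fin n × Fin p =>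
      ∑ j : Fin p, R j si.1 tk.1 * A si.1 si.2 j * A tk.1 tk.2 j) :
    IsUnit Sig.det ∧
      ∀ (s t : Fin n) (i k : Fin p),
        Sig⁻¹ (s, i) (t, k) =
          ∑ j : Fin p, (R j)⁻¹ s t * (A s)⁻¹ j i * (A t)⁻¹ j k := by
  have hmul : Sig * lmcCovariance (fun s => ((A s)⁻¹)ᵀ) (fun j => (R j)⁻¹) = 1 := by
    rw [hSig]
    exact lmcCovariance_mul_eq_one (fun s => Matrix.nonsing_inv_mul _ (hA s))
      fun j => Matrix.mul_nonsing_inv _ (hR j)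
  refine ⟨Matrix.isUnit_det_of_right_inverse hmul, fun s t i k => ?_⟩
  rw [Matrix.inv_eq_right_inv hmul]
  rfl
end
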